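/- Let t be a binary tree and let S_1,…,S_m be a partition of the node set of t such that each S_i is a subtree of t, with shapes μ_1,…,μ_m. If p is a monotonic fixed-height binary tree source, then P[t] ≤ ∏_{i=1}^m P[μ_i]. -/

import Mathlib

inductive BinTree : Type where
  | leaf : BinTree
  | node : BinTree → BinTree → BinTree
deriving DecidableEq

namespace BinTree

def size : BinTree → ℕ
  | leaf => 0
  | node l r => 1 + size l + size r

def height : BinTree → ℕ
  | leaf => 0
  | node l r => 1 + max (height l) (height r)

def subtreeAt : BinTree → List Bool → BinTree
  | t, [] => t
  | leaf, _ :: _ => leaf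
  | node l r, b :: v => subtreeAt (if b then r else l) v

def countGE (b : ℕ) : BinTree → ℕ
  | leaf => 0
  | node l r => (if b ≤ size (node l r) then 1 else 0) + countGE b l + countGE b r

end BinTree

noncomputable def fsProb (p : ℕ → ℕ → ℝ) : BinTree → ℝ
  | .leaf => 1
  | .node l r => p l.size r.size * fsProb p l * fsProb p r

noncomputable def fhProb (p : ℕ → ℕ → ℝ) : BinTree → ℝ
  | .leaf => 1
  | .node l r => p l.height r.height * fhProb p l * fhProb p r

def IsFixedSizeSource (p : ℕ → ℕ → ℝ) : Prop :=
  (∀ ℓ r, 0 ≤ p ℓ r ∧ p ℓ r ≤ 1) ∧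
  ∀ n : ℕ, ∑ ℓ ∈ Finset.range (n + 1), p ℓ (n - ℓ) = 1

def IsFixedHeightSource (p : ℕ → ℕ → ℝ) : Prop :=
  (∀ i j, 0 ≤ p i j ∧ p i j ≤ 1) ∧
  ∀ h : ℕ,
    ∑ ij ∈ (Finset.range (h + 1) ×ˢ Finset.range (h + 1)).filter
        (fun ij => max ij.1 ij.2 = h), p ij.1 ij.2 = 1

/-- The addresses in `S` that descend into the `b`-child of the root,
re-rooted at that child. -/
def descend (b : Bool) (S : Finset (List Bool)) : Finset (List Bool) :=
  (S.filter fun v => v.head? = some b).image List.tail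

/-- The shape of the subtree induced by the address set `S` (rooted at the
root of the given tree): a node is kept iff its address lies in `S`. -/
def shapeOf : BinTree → Finset (List Bool) → BinTree
  | .leaf, _ => .leaf
  | .node l r, S =>
      if ([] : List Bool) ∈ S then
        .node (shapeOf l (descend false S)) (shapeOf r (descend true S))
      else .leaf

/-- `S` is (the address set of) a subtree of `t` with root `ρ`: it contains
`ρ`, consists of nodes of `t` that are descendants of `ρ`, and contains the
parent of each of its non-root elements. -/
def IsSubtreeSet (t : BinTree) (S : Finset (List Bool)) (ρ : List Bool) : Prop :=
  ρ ∈ S ∧ (∀ v ∈ S, ρ <+: v) ∧ (∀ v ∈ S, v ≠ ρ → v.dropLast ∈ S) ∧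
    (∀ v ∈ S, t.subtreeAt v ≠ BinTree.leaf)

theorem mem_descend_iff (b : Bool) (U : Finset (List Bool)) (v : List Bool) :
    v ∈ descend b U ↔ b :: v ∈ U := by
  unfold descend
  simp only [Finset.mem_image, Finset.mem_filter]
  constructor
  · rintro ⟨w, ⟨hw, hh⟩, rfl⟩
    cases w with
    | nil => simp at hh
    | cons a w =>
      simp at hh
      subst hh
      simpa using hw
  · intro h
    exact ⟨b :: v, ⟨h, rfl⟩, rfl⟩

theorem prod_decomp (f : List Bool → ℝ) (U : Finset (List Bool)) :
    ∏ v ∈ U, f v = (if ([] : List Bool) ∈ U then f [] else 1) *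
      (∏ v ∈ descend false U, f (false :: v)) * ∏ v ∈ descend true U, f (true :: v) := by
  have key : U = (U.filter fun v => v = []) ∪
      (((descend false U).image (List.cons false)) ∪
        ((descend true U).image (List.cons true))) := by
    ext v
    rcases v with _ | ⟨_ | _, v⟩ <;> simp [mem_descend_iff]
  have h1 : Disjoint (U.filter fun v => v = []) (((descend false U).image (List.cons false)) ∪
        ((descend true U).image (List.cons true))) := by
    rw [Finset.disjoint_left]
    intro v hv
    have : v = [] := (Finset.mem_filter.1 hv).2
    subst this
    simp
  have h2 : Disjoint ((descend false U).image (List.cons false))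
        ((descend true U).image (List.cons true)) := by
    rw [Finset.disjoint_left]
    intro v hv hv2
    obtain ⟨a, _, rfl⟩ := Finset.mem_image.1 hv
    obtain ⟨c, _, h⟩ := Finset.mem_image.1 hv2
    simp at h
  conv_lhs => rw [key]
  rw [Finset.prod_union h1, Finset.prod_union h2, Finset.prod_image (by simp),
    Finset.prod_image (by simp), mul_assoc]
  congr 1
  rw [Finset.prod_filter]
  simp

/-- the factor of node `v` in `P[t]` -/
noncomputable def nodeFactor (p : ℕ → ℕ → ℝ) (t : BinTree) (v : List Bool) : ℝ :=
  p (t.subtreeAt (v ++ [false])).height (t.subtreeAt (v ++ [true])).height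

theorem subtreeAt_leaf (v : List Bool) : BinTree.leaf.subtreeAt v = BinTree.leaf := by
  cases v <;> rfl

theorem subtreeAt_append (t : BinTree) (v w : List Bool) :
    t.subtreeAt (v ++ w) = (t.subtreeAt v).subtreeAt w := by
  induction v generalizing t with
  | nil => cases t <;> rfl
  | cons b v ih =>
    cases t with
    | leaf => simp [subtreeAt_leaf]
    | node l r => simp [BinTree.subtreeAt, ih]

theorem height_shapeOf_le (t : BinTree) (U : Finset (List Bool)) :
    (shapeOf t U).height ≤ t.height := by
  induction t generalizing U with
  | leaf => simp [shapeOf]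
  | node l r ihl ihr =>
    unfold shapeOf
    split_ifs
    · have := ihl (descend false U)
      have := ihr (descend true U)
      simp only [BinTree.height]
      omega
    · simp [BinTree.height]

theorem fhProb_nonneg' {p : ℕ → ℕ → ℝ} (h01 : ∀ i j, 0 ≤ p i j ∧ p i j ≤ 1)
    (t : BinTree) : 0 ≤ fhProb p t := by
  induction t with
  | leaf => simp [fhProb]
  | node l r ihl ihr => exact mul_nonneg (mul_nonneg (h01 _ _).1 ihl) ihr

theorem prod_factor_le_one {p : ℕ → ℕ → ℝ} (h01 : ∀ i j, 0 ≤ p i j ∧ p i j ≤ 1)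
    (t : BinTree) (U : Finset (List Bool)) :
    ∏ v ∈ U, nodeFactor p t v ≤ 1 :=
  Finset.prod_le_one (fun _ _ => (h01 _ _).1) (fun _ _ => (h01 _ _).2)

theorem prod_factor_nonneg {p : ℕ → ℕ → ℝ} (h01 : ∀ i j, 0 ≤ p i j ∧ p i j ≤ 1)
    (t : BinTree) (U : Finset (List Bool)) :
    0 ≤ ∏ v ∈ U, nodeFactor p t v :=
  Finset.prod_nonneg (fun _ _ => (h01 _ _).1)

theorem fhProb_le_prod {p : ℕ → ℕ → ℝ} (h01 : ∀ i j, 0 ≤ p i j ∧ p i j ≤ 1)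
    (t : BinTree) (U : Finset (List Bool))
    (hU : ∀ v ∈ U, t.subtreeAt v ≠ BinTree.leaf) :
    fhProb p t ≤ ∏ v ∈ U, nodeFactor p t v := by
  induction t generalizing U with
  | leaf =>
    have : U = ∅ := Finset.eq_empty_of_forall_notMem
      (fun v hv => hU v hv (subtreeAt_leaf v))
    simp [this, fhProb]
  | node l r ihl ihr =>
    rw [prod_decomp]
    have hl := ihl (descend false U) (fun v hv => by
      simpa [BinTree.subtreeAt] using hU _ ((mem_descend_iff _ _ _).1 hv))
    have hr := ihr (descend true U) (fun v hv => by
      simpa [BinTree.subtreeAt] using hU _ ((mem_descend_iff _ _ _).1 hv))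
    have h0 : p l.height r.height ≤
        if ([] : List Bool) ∈ U then nodeFactor p (.node l r) [] else 1 := by
      split_ifs
      · simp [nodeFactor, BinTree.subtreeAt]
      · exact (h01 _ _).2
    have hn := (h01 l.height r.height).1
    exact mul_le_mul (mul_le_mul h0 hl (fhProb_nonneg' h01 _) (hn.trans h0)) hr
      (fhProb_nonneg' h01 _)
      (mul_nonneg (hn.trans h0) (prod_factor_nonneg h01 l _))

theorem prod_le_fhProb_shape {p : ℕ → ℕ → ℝ} (h01 : ∀ i j, 0 ≤ p i j ∧ p i j ≤ 1)
    (hm : ∀ a b c d, a ≤ b → c ≤ d → p b d ≤ p a c)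
    (t : BinTree) (U : Finset (List Bool)) :
    ∏ v ∈ U, nodeFactor p t v ≤ fhProb p (shapeOf t U) := by
  induction t generalizing U with
  | leaf => exact prod_factor_le_one h01 _ _
  | node l r ihl ihr =>
    unfold shapeOf
    split_ifs with h
    · rw [prod_decomp, if_pos h]
      have h0 : nodeFactor p (.node l r) [] ≤
          p (shapeOf l (descend false U)).height (shapeOf r (descend true U)).height :=
        hm _ _ _ _ (height_shapeOf_le l _) (height_shapeOf_le r _)
      have hn := h01 (shapeOf l (descend false U)).height (shapeOf r (descend true U)).height
      exact mul_le_mul (mul_le_mul h0 (ihl _) (prod_factor_nonneg h01 l _) hn.1) (ihr _)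
        (prod_factor_nonneg h01 r _) (mul_nonneg hn.1 (fhProb_nonneg' h01 _))
    · exact prod_factor_le_one h01 _ _

/-- monotonicity implies submultiplicativity (fixed-height case):
if the nodes of `t` are partitioned into subtrees with shapes
`μ_1, …, μ_m`, then `P[t] ≤ ∏ P[μ_i]` for a monotonic fixed-height source. -/
theorem statement4 (p : ℕ → ℕ → ℝ) (hp : IsFixedHeightSource p)
    (hmono : ∀ ℓ r : ℕ, p (ℓ + 1) r ≤ p ℓ r ∧ p ℓ (r + 1) ≤ p ℓ r)
    (t : BinTree) (m : ℕ) (S : Fin m → Finset (List Bool)) (ρ : Fin m → List Bool)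
    (hsub : ∀ i, IsSubtreeSet t (S i) (ρ i))
    (hdisj : ∀ i j, i ≠ j → Disjoint (S i) (S j))
    (hcover : ∀ v : List Bool, t.subtreeAt v ≠ BinTree.leaf → ∃ i, v ∈ S i) :
    fhProb p t ≤ ∏ i : Fin m,
      fhProb p (shapeOf (t.subtreeAt (ρ i))
        ((S i).image fun v => v.drop (ρ i).length)) := by
  have h01 := hp.1
  have hm : ∀ a b c d, a ≤ b → c ≤ d → p b d ≤ p a c := by
    intro a b c d hab hcd
    exact (antitone_nat_of_succ_le (f := fun x => p x d) (fun k => (hmono k d).1) hab).trans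
      (antitone_nat_of_succ_le (f := fun x => p a x) (fun k => (hmono a k).2) hcd)
  have h1 := fhProb_le_prod h01 t (Finset.univ.biUnion S) (by
    intro v hv
    obtain ⟨i, _, hi⟩ := Finset.mem_biUnion.1 hv
    exact (hsub i).2.2.2 v hi)
  rw [Finset.prod_biUnion (fun i _ j _ hij => hdisj i j hij)] at h1
  refine h1.trans (Finset.prod_le_prod (fun i _ => prod_factor_nonneg h01 _ _) fun i _ => ?_)
  refine le_trans (le_of_eq ?_) (prod_le_fhProb_shape h01 hm _ _)
  have hpre : ∀ v ∈ S i, ρ i ++ v.drop (ρ i).length = v := by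
    intro v hv
    obtain ⟨w, rfl⟩ := (hsub i).2.1 v hv
    simp
  rw [Finset.prod_image]
  · refine Finset.prod_congr rfl fun v hv => ?_
    unfold nodeFactor
    rw [← subtreeAt_append, ← subtreeAt_append, ← List.append_assoc, ← List.append_assoc,
      hpre v hv]
  · intro v hv w hw h
    rw [← hpre v hv, ← hpre w hw]
    exact congrArg _ h
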